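/- Suppose n = 0, so F = F_{0,k,l} is free on Y ∪ Z and V̄ = F^{ab}. For f ∈ K_{0,k,l} and each generator v ∈ Y ∪ Z, choose w_v ∈ F with f(v) = w_v v w_v^{-1}; then the element w̄_v ∧ v̄ ∈ ∧²V̄ is independent of the choice of w_v, and the map J : K_{0,k,l} → Hom(V̄, ∧²V̄), sending f to the unique group homomorphism V̄ → ∧²V̄ with v̄ ↦ w̄_v ∧ v̄ for each generator v, is a well-defined group homomorphism (the Johnson homomorphism). -/

import Mathlib

namespace Birman

/-- The generating set of the free group `F_{n,k,l}`: `X ∪ Y ∪ Z`. -/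
abbrev Gen (n k l : ℕ) := Fin n ⊕ (Fin k ⊕ Fin l)

/-- The free group `F_{n,k,l}` on `X ∪ Y ∪ Z`. -/
abbrev FG (n k l : ℕ) := FreeGroup (Gen n k l)

variable {n k l : ℕ}

/-- The generator `x_i`. -/
def xg (n k l : ℕ) (i : Fin n) : Gen n k l := Sum.inl i
/-- The generator `y_j`. -/
def yg (n k l : ℕ) (j : Fin k) : Gen n k l := Sum.inr (Sum.inl j)
/-- The generator `z_m`. -/
def zg (n k l : ℕ) (m : Fin l) : Gen n k l := Sum.inr (Sum.inr m)

/-- `A_{n,k,l}`: automorphisms sending each generator in `Y ∪ Z` to a conjugate of itself. -/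
def A (n k l : ℕ) : Subgroup (MulAut (FG n k l)) where
  carrier := {f | ∀ s : Fin k ⊕ Fin l,
    IsConj (FreeGroup.of (Sum.inr s : Gen n k l)) (f (FreeGroup.of (Sum.inr s)))}
  one_mem' := by
    intro s
    rw [MulAut.one_apply]
  mul_mem' := by
    intro f g hf hg s
    rw [MulAut.mul_apply]
    exact (hf s).trans (f.toMonoidHom.map_isConj (hg s))
  inv_mem' := by
    intro f hf s
    have h := (f⁻¹ : MulAut (FG n k l)).toMonoidHom.map_isConj (hf s)
    simp only [MulEquiv.toMonoidHom_eq_coe, MonoidHom.coe_coe] at h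
    have h2 : (f⁻¹ : MulAut (FG n k l)) (f (FreeGroup.of (Sum.inr s))) = FreeGroup.of (Sum.inr s) :=
      MulAut.inv_apply_self _ f _
    rw [h2] at h
    exact h.symm

/-- The projection `F_{n,k,l} → F_{n,0,l}` killing the generators in `Y`. -/
def proj (n k l : ℕ) : FG n k l →* FG n 0 l :=
  FreeGroup.lift fun g => match g with
    | Sum.inl i => FreeGroup.of (Sum.inl i)
    | Sum.inr (Sum.inl _) => 1
    | Sum.inr (Sum.inr m) => FreeGroup.of (Sum.inr (Sum.inr m))

/-- Automorphisms commuting with the projection to `F_{n,0,l}`, i.e. inducing the identity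
on `F_{n,k,l}/N ≅ F_{n,0,l}`. -/
def fixProj (n k l : ℕ) : Subgroup (MulAut (FG n k l)) where
  carrier := {f | ∀ w : FG n k l, proj n k l (f w) = proj n k l w}
  one_mem' := by intro w; simp
  mul_mem' := by
    intro f g hf hg w
    rw [MulAut.mul_apply]
    exact (hf (g w)).trans (hg w)
  inv_mem' := by
    intro f hf w
    have h := hf ((f⁻¹ : MulAut (FG n k l)) w)
    rw [MulAut.apply_inv_self] at h
    exact h.symm

/-- `K_{n,k,l}`, the kernel of `ρ : A_{n,k,l} → A_{n,0,l}`: those elements of `A_{n,k,l}`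
that induce the identity automorphism of `F_{n,k,l}/N ≅ F_{n,0,l}`. -/
def K (n k l : ℕ) : Subgroup (MulAut (FG n k l)) := A n k l ⊓ fixProj n k l

/-- `f` is the automorphism `M_{v,w}` : `v ↦ w v`, fixing all other generators. -/
def IsMul (f : MulAut (FG n k l)) (v w : Gen n k l) : Prop :=
  f (FreeGroup.of v) = FreeGroup.of w * FreeGroup.of v ∧
    ∀ u : Gen n k l, u ≠ v → f (FreeGroup.of u) = FreeGroup.of u

/-- `f` is the automorphism `M_{v⁻¹,w}` : `v ↦ v w⁻¹`, fixing all other generators. -/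
def IsMulInv (f : MulAut (FG n k l)) (v w : Gen n k l) : Prop :=
  f (FreeGroup.of v) = FreeGroup.of v * (FreeGroup.of w)⁻¹ ∧
    ∀ u : Gen n k l, u ≠ v → f (FreeGroup.of u) = FreeGroup.of u

/-- `f` is the automorphism `C_{v,w}` : `v ↦ w v w⁻¹`, fixing all other generators. -/
def IsConjGen (f : MulAut (FG n k l)) (v w : Gen n k l) : Prop :=
  f (FreeGroup.of v) = FreeGroup.of w * FreeGroup.of v * (FreeGroup.of w)⁻¹ ∧
    ∀ u : Gen n k l, u ≠ v → f (FreeGroup.of u) = FreeGroup.of u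

end Birman

namespace Birman

/-- The image of `u ∈ F` in `V̄ = F^{ab}`, written additively. -/
def abv (k l : ℕ) (u : FG 0 k l) : Additive (Abelianization (FG 0 k l)) :=
  Additive.ofMul (Abelianization.of u)

/-- The wedge `a ∧ b ∈ ⋀² V̄` of two elements of `V̄`. -/
noncomputable def wedge (k l : ℕ) (a b : Additive (Abelianization (FG 0 k l))) :
    ↥(⋀[ℤ]^2 (Additive (Abelianization (FG 0 k l)))) :=
  ⟨ExteriorAlgebra.ιMulti ℤ 2 ![a, b],
    ExteriorAlgebra.ιMulti_range ℤ 2 (Set.mem_range_self _)⟩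

/-- A Heisenberg-type group on `ℤ × V × V`. -/
@[ext] structure Heis (V : Type) where
  /-- first coordinate -/
  m : ℤ
  /-- second coordinate -/
  a : V
  /-- third coordinate -/
  s : V

instance heisGroup (V : Type) [AddCommGroup V] : Group (Heis V) where
  mul x y := ⟨x.m + y.m, x.a + y.a, x.s + y.s + x.m • y.a⟩
  one := ⟨0, 0, 0⟩
  inv x := ⟨-x.m, -x.a, -x.s + x.m • x.a⟩
  mul_assoc x y z := by
    apply Heis.ext
    · exact add_assoc _ _ _
    · exact add_assoc _ _ _
    · change (x.s + y.s + x.m • y.a) + z.s + (x.m + y.m) • z.a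
        = x.s + (y.s + z.s + y.m • z.a) + x.m • (y.a + z.a)
      module
  one_mul x := by
    apply Heis.ext
    · exact zero_add _
    · exact zero_add _
    · change 0 + x.s + (0 : ℤ) • x.a = x.s
      module
  mul_one x := by
    apply Heis.ext
    · exact add_zero _
    · exact add_zero _
    · change x.s + 0 + x.m • (0 : V) = x.s
      module
  inv_mul_cancel x := by
    apply Heis.ext
    · exact neg_add_cancel _
    · exact neg_add_cancel _
    · change (-x.s + x.m • x.a) + x.s + (-x.m) • x.a = 0
      module

/-- The second coordinate as a homomorphism. -/
def heisA (V : Type) [AddCommGroup V] : Heis V →* Multiplicative V where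
  toFun x := Multiplicative.ofAdd x.a
  map_one' := rfl
  map_mul' _ _ := rfl

/-- If `u` commutes with a generator `v`, then `ū` is a multiple of `v̄`. -/
theorem exists_zsmul_of_commute (k l : ℕ) (v : Gen 0 k l) (u : FG 0 k l)
    (h : u * FreeGroup.of v = FreeGroup.of v * u) :
    ∃ m : ℤ, abv k l u = m • abv k l (FreeGroup.of v) := by
  classical
  let φ : FG 0 k l →* Heis (Additive (Abelianization (FG 0 k l))) :=
    FreeGroup.lift fun x => ⟨if x = v then 1 else 0, abv k l (FreeGroup.of x), 0⟩
  have hA : ∀ x, (φ x).a = abv k l x := by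
    have : (heisA _).comp φ =
        (AddMonoidHom.toMultiplicativeRight (MonoidHom.toAdditive
          (Abelianization.of (G := FG 0 k l)))).comp
          (MulEquiv.refl (FG 0 k l)).toMonoidHom := by
      ext x
      simp [φ, heisA, abv]
    intro x
    exact congrArg Multiplicative.toAdd (DFunLike.congr_fun this x)
  have hv : φ (FreeGroup.of v) = ⟨1, abv k l (FreeGroup.of v), 0⟩ := by
    simp [φ]
  have h1 : φ u * φ (FreeGroup.of v) = φ (FreeGroup.of v) * φ u := by
    rw [← map_mul, h, map_mul]
  rw [hv] at h1
  have h2 : (φ u).s + 0 + (φ u).m • abv k l (FreeGroup.of v)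
      = 0 + (φ u).s + (1 : ℤ) • (φ u).a := congrArg Heis.s h1
  refine ⟨(φ u).m, ?_⟩
  rw [hA] at h2
  simpa using h2.symm

theorem abv_mul (k l : ℕ) (u w : FG 0 k l) : abv k l (u * w) = abv k l u + abv k l w := by
  simp [abv]

theorem wedge_eq (k l : ℕ) (a b : Additive (Abelianization (FG 0 k l))) :
    wedge k l a b = exteriorPower.ιMulti ℤ 2 ![a, b] := rfl

theorem wedge_add (k l : ℕ) (a a' b : Additive (Abelianization (FG 0 k l))) :
    wedge k l (a + a') b = wedge k l a b + wedge k l a' b := by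
  have h := (exteriorPower.ιMulti ℤ 2 (M := Additive (Abelianization (FG 0 k l)))).map_update_add
    ![a, b] 0 a a'
  have e : ∀ c, Function.update ![a, b] 0 c = ![c, b] := by
    intro c
    ext i; fin_cases i <;> simp
  rw [e, e, e] at h
  exact h

theorem wedge_zsmul_self (k l : ℕ) (m : ℤ) (b : Additive (Abelianization (FG 0 k l))) :
    wedge k l (m • b) b = 0 := by
  have h := (exteriorPower.ιMulti ℤ 2 (M := Additive (Abelianization (FG 0 k l)))).map_update_smul
    ![b, b] 0 m b
  have h0 : exteriorPower.ιMulti ℤ 2 ![b, b] = 0 :=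
    AlternatingMap.map_eq_zero_of_eq _ _ (i := 0) (j := 1) rfl (by decide)
  rw [wedge_eq]
  have e1 : Function.update ![b, b] 0 (m • b) = ![m • b, b] := by
    ext i; fin_cases i <;> simp
  have e2 : Function.update ![b, b] 0 b = ![b, b] := by
    ext i; fin_cases i <;> simp
  rw [e1, e2, h0, smul_zero] at h
  exact h

theorem wedge_indep (k l : ℕ) (v : Gen 0 k l) (w w' : FG 0 k l)
    (h : w * FreeGroup.of v * w⁻¹ = w' * FreeGroup.of v * w'⁻¹) :
    wedge k l (abv k l w) (abv k l (FreeGroup.of v)) =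
      wedge k l (abv k l w') (abv k l (FreeGroup.of v)) := by
  have hc : (w'⁻¹ * w) * FreeGroup.of v = FreeGroup.of v * (w'⁻¹ * w) := by
    have h' := congrArg (fun t => w'⁻¹ * t * w) h
    simpa [mul_assoc] using h'
  obtain ⟨m, hm⟩ := exists_zsmul_of_commute k l v _ hc
  have hw : abv k l w = abv k l w' + m • abv k l (FreeGroup.of v) := by
    rw [← hm, ← abv_mul, mul_inv_cancel_left]
  rw [hw, wedge_add, wedge_zsmul_self, add_zero]

theorem exists_conj (k l : ℕ) (f : MulAut (FG 0 k l)) (hf : f ∈ K 0 k l) (v : Gen 0 k l) :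
    ∃ w : FG 0 k l, f (FreeGroup.of v) = w * FreeGroup.of v * w⁻¹ := by
  rcases v with i | s
  · exact i.elim0
  · obtain ⟨c, hc⟩ := isConj_iff.1 (hf.1 s)
    exact ⟨c, hc.symm⟩

theorem abv_apply (k l : ℕ) (f : MulAut (FG 0 k l)) (hf : f ∈ K 0 k l) (u : FG 0 k l) :
    abv k l (f u) = abv k l u := by
  have : (Abelianization.of (G := FG 0 k l)).comp f.toMonoidHom = Abelianization.of := by
    ext v
    obtain ⟨w, hw⟩ := exists_conj k l f hf v
    simp [hw]
  exact congrArg Additive.ofMul (DFunLike.congr_fun this u)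

/-- Linear maps out of `V̄` are determined by, and can be prescribed on, generators. -/
noncomputable def linLift (k l : ℕ) {W : Type} [AddCommGroup W] (c : Gen 0 k l → W) :
    Additive (Abelianization (FG 0 k l)) →ₗ[ℤ] W :=
  (MonoidHom.toAdditiveLeft (Abelianization.lift
    (FreeGroup.lift fun v => Multiplicative.ofAdd (c v)))).toIntLinearMap

theorem linLift_of (k l : ℕ) {W : Type} [AddCommGroup W] (c : Gen 0 k l → W) (v : Gen 0 k l) :
    linLift k l c (abv k l (FreeGroup.of v)) = c v := by
  simp [linLift, abv]

theorem lin_ext (k l : ℕ) {W : Type} [AddCommGroup W]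
    (p q : Additive (Abelianization (FG 0 k l)) →ₗ[ℤ] W)
    (h : ∀ v, p (abv k l (FreeGroup.of v)) = q (abv k l (FreeGroup.of v))) : p = q := by
  have : (AddMonoidHom.toMultiplicativeRight p.toAddMonoidHom).comp Abelianization.of =
      (AddMonoidHom.toMultiplicativeRight q.toAddMonoidHom).comp Abelianization.of := by
    apply FreeGroup.ext_hom
    intro v
    exact congrArg Multiplicative.ofAdd (h v)
  have h2 := Abelianization.hom_ext _ _ this
  ext x
  exact congrArg Multiplicative.toAdd (DFunLike.congr_fun h2 x.toMul)

/-- **The Johnson homomorphism for `n = 0`.**  For `f ∈ K_{0,k,l}` and a generator `v`, every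
choice of `w` with `f(v) = w v w⁻¹` yields the same element `w̄ ∧ v̄ ∈ ⋀²V̄`; moreover there
is a map `J : K_{0,k,l} → Hom(V̄, ⋀²V̄)` with `J(f)(v̄) = w̄ ∧ v̄` on each generator `v`
(which determines `J(f)` uniquely), and `J` is a group homomorphism. -/
theorem johnson_homomorphism_n_zero (k l : ℕ) (hk : 0 < k) :
    (∀ f ∈ K 0 k l, ∀ v : Gen 0 k l, ∃ w : FG 0 k l,
      f (FreeGroup.of v) = w * FreeGroup.of v * w⁻¹) ∧
    (∀ f ∈ K 0 k l, ∀ v : Gen 0 k l, ∀ w w' : FG 0 k l,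
      f (FreeGroup.of v) = w * FreeGroup.of v * w⁻¹ →
      f (FreeGroup.of v) = w' * FreeGroup.of v * w'⁻¹ →
      wedge k l (abv k l w) (abv k l (FreeGroup.of v)) =
        wedge k l (abv k l w') (abv k l (FreeGroup.of v))) ∧
    ∃ J : ↥(K 0 k l) → (Additive (Abelianization (FG 0 k l)) →ₗ[ℤ]
        ↥(⋀[ℤ]^2 (Additive (Abelianization (FG 0 k l))))),
      (∀ (f : ↥(K 0 k l)) (v : Gen 0 k l) (w : FG 0 k l),
        (f : MulAut (FG 0 k l)) (FreeGroup.of v) = w * FreeGroup.of v * w⁻¹ →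
        J f (abv k l (FreeGroup.of v)) =
          wedge k l (abv k l w) (abv k l (FreeGroup.of v))) ∧
      (∀ f g : ↥(K 0 k l), J (f * g) = J f + J g) := by
  refine ⟨exists_conj k l, fun f _ v w w' h h' => wedge_indep k l v w w' (h.symm.trans h'), ?_⟩
  choose W hW using fun (f : ↥(K 0 k l)) (v : Gen 0 k l) => exists_conj k l f.1 f.2 v
  have key : ∀ (f : ↥(K 0 k l)) (v : Gen 0 k l) (w : FG 0 k l),
      (f : MulAut (FG 0 k l)) (FreeGroup.of v) = w * FreeGroup.of v * w⁻¹ →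
      linLift k l (fun v => wedge k l (abv k l (W f v)) (abv k l (FreeGroup.of v)))
        (abv k l (FreeGroup.of v)) = wedge k l (abv k l w) (abv k l (FreeGroup.of v)) := by
    intro f v w h
    rw [linLift_of]
    exact wedge_indep k l v _ _ ((hW f v).symm.trans h)
  refine ⟨fun f => linLift k l
    (fun v => wedge k l (abv k l (W f v)) (abv k l (FreeGroup.of v))), key, ?_⟩
  intro f g
  apply lin_ext
  intro v
  have hfg : ((f * g : ↥(K 0 k l)) : MulAut (FG 0 k l)) (FreeGroup.of v) =
      ((f : MulAut (FG 0 k l)) (W g v) * W f v) * FreeGroup.of v *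
        ((f : MulAut (FG 0 k l)) (W g v) * W f v)⁻¹ := by
    rw [Subgroup.coe_mul, MulAut.mul_apply, hW g v, map_mul, map_mul, map_inv, hW f v]
    group
  rw [key (f * g) v _ hfg, LinearMap.add_apply, key f v _ (hW f v), key g v _ (hW g v),
    abv_mul, abv_apply k l f.1 f.2, wedge_add, add_comm]

end Birman
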